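/- arXiv:2102.02196 — 6 statements merged into one kernel-verified Lean document; each statement's English description precedes it below -/
import Mathlib

section
/- Let F ∈ ℝ, D ∈ (0,1), σ > 0 and let k ≥ 1 be an integer. For the sampling process with parameters (F, D, σ²), the delay-k autocorrelation satisfies C_k(F, D, σ²) = C_1(kF mod 1, D, kσ²); that is, the probability that z_i = z_{i+k} under parameters (F, D, σ²) equals the probability that z_i = z_{i+1} under parameters (kF mod 1, D, kσ²). -/
open MeasureTheory ProbabilityTheory Real Set

/-- The noise step measure: Gaussian with mean `F` and variance `v`. -/
noncomputable def stepGauss (F v : ℝ) : Measure ℝ := gaussianReal F v.toNNReal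

/-- Finite-window probability space for the sampling process: an initial phase,
uniform on `[0,1)`, together with `n` i.i.d. Gaussian increments of mean `F`
and variance `v`. -/
noncomputable def procMeasure (F v : ℝ) (n : ℕ) : Measure (ℝ × (Fin n → ℝ)) :=
  (volume.restrict (Set.Ico (0:ℝ) 1)).prod (Measure.pi fun _ : Fin n => stepGauss F v)

/-- The phase `x_j` of the sampling process: initial phase plus the first `j`
Gaussian increments, reduced mod 1. -/
noncomputable def phase {n : ℕ} (ω : ℝ × (Fin n → ℝ)) (j : ℕ) : ℝ :=
  Int.fract (ω.1 + ∑ i : Fin n, if (i : ℕ) < j then ω.2 i else 0)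

/-- Output bit of the sampler at phase `x`: `1` iff `x < D`. -/
noncomputable def bit (D x : ℝ) : Bool := decide (x < D)

/-- Probability that the output bits `z_1, …, z_n` of the sampling process with
parameters `(F, D, v)` form exactly the pattern `z`. -/
noncomputable def patternProb (F D v : ℝ) (n : ℕ) (z : Fin n → Bool) : ℝ :=
  (procMeasure F v n {ω | ∀ j : Fin n, bit D (phase ω ((j : ℕ) + 1)) = z j}).toReal

/-- Probability that `z_i = z_{i+k}` in the sampling process with parameters `(F, D, v)`. -/
noncomputable def agreeProb (F D v : ℝ) (i k : ℕ) : ℝ :=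
  (procMeasure F v (i + k) {ω | bit D (phase ω i) = bit D (phase ω (i + k))}).toReal

/-- The wrapped Gaussian step density `f_s` with frequency `F` and variance `v`. -/
noncomputable def stepDensity (F v : ℝ) (x : ℝ) : ℝ :=
  (1 / Real.sqrt (2 * Real.pi * v)) * ∑' i : ℤ, Real.exp (-(x - F + (i : ℝ))^2 / (2 * v))

/-- The law of a sum of i.i.d. Gaussian coordinates. -/
theorem measurePreserving_sum_pi_gaussianReal {ι : Type*} [Fintype ι] (m : ℝ) (v : NNReal)
    (s : Finset ι) :
    MeasurePreserving (fun y : ι → ℝ => ∑ i ∈ s, y i)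
      (Measure.pi fun _ : ι => gaussianReal m v) (gaussianReal (s.card * m) (s.card * v)) := by
  classical
  refine ⟨by fun_prop, ?_⟩
  induction s using Finset.induction_on with
  | empty => simp
  | insert a s ha ih =>
    have hind : iIndepFun (fun (i : ι) (y : ι → ℝ) => y i)
        (Measure.pi fun _ : ι => gaussianReal m v) :=
      iIndepFun_pi (X := fun _ => id) fun _ => aemeasurable_id
    have hsa : IndepFun (fun y : ι → ℝ => ∑ i ∈ s, y i) (fun y => y a)
        (Measure.pi fun _ : ι => gaussianReal m v) := by
      convert hind.indepFun_finsetSum_of_notMem (fun i => measurable_pi_apply i) ha using 1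
      ext y
      simp
    have h := gaussianReal_add_gaussianReal_of_indepFun hsa ih
      (measurePreserving_eval (fun _ : ι => gaussianReal m v) a).map_eq
    have hsum : (fun y : ι → ℝ => ∑ i ∈ insert a s, y i)
        = (fun y : ι → ℝ => ∑ i ∈ s, y i) + fun y => y a := by
      ext y
      simp [Finset.sum_insert ha, add_comm]
    rw [hsum, h, Finset.card_insert_of_notMem ha]
    push_cast
    simp only [add_mul, one_mul]

/-- The uniform distribution on `[0, 1)` is invariant under translation mod 1. -/
theorem measurePreserving_fract_add (a : ℝ) :
    MeasurePreserving (fun x : ℝ => Int.fract (x + a))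
      (volume.restrict (Set.Ico (0 : ℝ) 1)) (volume.restrict (Set.Ico (0 : ℝ) 1)) := by
  have hmeas : Measurable fun x : ℝ => Int.fract (x + a) :=
    measurable_fract.comp (measurable_id.add_const a)
  refine ⟨hmeas, Measure.ext fun t ht => ?_⟩
  have hG : MeasurableSet ((Int.fract : ℝ → ℝ) ⁻¹' t) := measurable_fract ht
  have hinv : ∀ g : AddSubgroup.zmultiples (1 : ℝ),
      (fun x => g +ᵥ x) ⁻¹' ((Int.fract : ℝ → ℝ) ⁻¹' t) = (Int.fract : ℝ → ℝ) ⁻¹' t := by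
    rintro ⟨_, n, rfl⟩
    ext x
    simp [AddSubgroup.vadd_def]
  have hper := (isAddFundamentalDomain_Ioc one_pos a).measure_set_eq
    (isAddFundamentalDomain_Ioc one_pos 0) hG hinv
  have hshift : (fun x : ℝ => Int.fract (x + a)) ⁻¹' t ∩ Set.Ioc 0 1
      = (fun x => x + a) ⁻¹' ((Int.fract : ℝ → ℝ) ⁻¹' t ∩ Set.Ioc a (a + 1)) := by
    ext x
    simp [add_comm a]
  have hfract : t ∩ Set.Ico 0 1 = (Int.fract : ℝ → ℝ) ⁻¹' t ∩ Set.Ico 0 1 := by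
    ext x
    simp only [Set.mem_inter_iff, Set.mem_preimage, and_congr_left_iff]
    intro hx
    rw [Int.fract_eq_self.2 hx]
  have hUnif : volume.restrict (Set.Ico (0 : ℝ) 1) = volume.restrict (Set.Ioc (0 : ℝ) 1) :=
    Measure.restrict_congr_set Ico_ae_eq_Ioc
  calc Measure.map (fun x : ℝ => Int.fract (x + a)) (volume.restrict (Set.Ico (0 : ℝ) 1)) t
      = volume ((Int.fract : ℝ → ℝ) ⁻¹' t ∩ Set.Ioc a (a + 1)) := by
        rw [Measure.map_apply hmeas ht, hUnif, Measure.restrict_apply (hmeas ht), hshift,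
          measure_preimage_add_right]
    _ = volume.restrict (Set.Ico (0 : ℝ) 1) ((Int.fract : ℝ → ℝ) ⁻¹' t) := by
        rw [hper, zero_add, hUnif, Measure.restrict_apply hG]
    _ = volume.restrict (Set.Ico (0 : ℝ) 1) t := by
        rw [Measure.restrict_apply hG, Measure.restrict_apply ht, hfract]

theorem measurable_bit (D : ℝ) : Measurable (bit D) :=
  measurable_to_bool <| by
    convert measurableSet_Iio (a := D) using 1
    ext x
    simp [bit]

/-- The pairs (phase, increment) for which the bit is unchanged by the increment. -/
def agreeSet (D : ℝ) : Set (ℝ × ℝ) := {p | bit D p.2 = bit D (Int.fract (p.2 + p.1))}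

theorem measurableSet_agreeSet (D : ℝ) : MeasurableSet (agreeSet D) :=
  measurableSet_eq_fun ((measurable_bit D).comp measurable_snd)
    ((measurable_bit D).comp (measurable_fract.comp (measurable_snd.add measurable_fst)))

/-- The agreement probability at delay `k` only involves one uniform phase and one Gaussian
increment, with `k` times the mean and variance. -/
theorem agreeProb_eq (F D v : ℝ) (i k : ℕ) :
    agreeProb F D v i k = ((gaussianReal (k * F) (k * v.toNNReal)).prod
      (volume.restrict (Set.Ico (0 : ℝ) 1)) (agreeSet D)).toReal := by
  set s : Finset (Fin (i + k)) := {j | ¬ (j : ℕ) < i}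
  have hcard : s.card = k := by
    have h : s = Finset.univ.map (Fin.natAddEmb (m := k) i) := by
      ext j
      refine Fin.addCases (fun l => ?_) (fun l => ?_) j
      · simp only [s, Finset.mem_filter_univ, Finset.mem_map, Finset.mem_univ, true_and,
          Fin.natAddEmb_apply, Fin.ext_iff, Fin.val_castAdd, Fin.val_natAdd]
        exact iff_of_false (not_not_intro l.isLt) fun ⟨a, ha⟩ => by omega
      · simp [s]
    rw [h]
    simp
  have hB := measurePreserving_sum_pi_gaussianReal F v.toNNReal s
  rw [hcard] at hB
  set A : (Fin (i + k) → ℝ) → ℝ := fun y => ∑ j : Fin (i + k), if (j : ℕ) < i then y j else 0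
  have hA : Measurable A := Finset.measurable_sum _ fun j _ => by
    split_ifs <;> fun_prop
  have hskew := (hB.skew_product (g := fun y x => Int.fract (x + A y))
    (measurable_fract.comp (measurable_snd.add (hA.comp measurable_fst)))
    (ae_of_all _ fun y => (measurePreserving_fract_add (A y)).map_eq)).comp
    (Measure.measurePreserving_swap (μ := volume.restrict (Set.Ico (0 : ℝ) 1)))
  have hset : {ω : ℝ × (Fin (i + k) → ℝ) | bit D (phase ω i) = bit D (phase ω (i + k))}
      = ((fun p : (Fin (i + k) → ℝ) × ℝ => (∑ j ∈ s, p.1 j, Int.fract (p.2 + A p.1)))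
        ∘ Prod.swap) ⁻¹' agreeSet D := by
    ext ⟨x, y⟩
    have hsplit : ∑ j, y j = A y + ∑ j ∈ s, y j := by
      simp only [A, s, ← Finset.sum_filter]
      exact (Finset.sum_filter_add_sum_filter_not _ _ _).symm
    have hstep : Int.fract (Int.fract (x + A y) + ∑ j ∈ s, y j)
        = Int.fract (x + ∑ j, y j) := by
      rw [hsplit, ← add_assoc, Int.fract_eq_fract]
      exact ⟨-⌊x + A y⌋, by push_cast; linarith [Int.fract_add_floor (x + A y)]⟩
    simp [agreeSet, phase, hstep, A]
  rw [agreeProb, hset]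
  exact congrArg ENNReal.toReal
    (hskew.measure_preimage (measurableSet_agreeSet D).nullMeasurableSet)

/-- Integer parts of the mean increment do not affect agreement of bits. -/
theorem gaussianReal_prod_agreeSet_fract (m D : ℝ) (v : NNReal) (μ : Measure ℝ) [SFinite μ] :
    (gaussianReal (Int.fract m) v).prod μ (agreeSet D)
      = (gaussianReal m v).prod μ (agreeSet D) := by
  have hshift : MeasurePreserving (fun y : ℝ => y + (⌊m⌋ : ℝ))
      (gaussianReal (Int.fract m) v) (gaussianReal m v) :=
    ⟨by fun_prop, by rw [gaussianReal_map_add_const, Int.fract_add_floor]⟩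
  rw [← (hshift.prod (MeasurePreserving.id μ)).measure_preimage
    (measurableSet_agreeSet D).nullMeasurableSet]
  congr 1
  ext ⟨y, x⟩
  simp [agreeSet, ← add_assoc]

/-- For the sampling process with parameters `(F, D, σ²)` and any
`k ≥ 1`, the delay-`k` autocorrelation `C_k = 2·Pr(z_i = z_{i+k}) − 1` satisfies
`C_k(F, D, σ²) = C_1(kF mod 1, D, kσ²)`: the probability that `z_i = z_{i+k}` under
`(F, D, σ²)` equals the probability that `z_i = z_{i+1}` under `(kF mod 1, D, kσ²)`. -/
theorem autocorr_delay_k (F D σ : ℝ) (hD : D ∈ Set.Ioo (0:ℝ) 1) (hσ : 0 < σ)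
    (k : ℕ) (hk : 1 ≤ k) (i : ℕ) (hi : 1 ≤ i) :
    2 * agreeProb F D (σ^2) i k - 1
      = 2 * agreeProb (Int.fract ((k : ℝ) * F)) D ((k : ℝ) * σ^2) i 1 - 1 := by
  rw [agreeProb_eq, agreeProb_eq, Nat.cast_one, Nat.cast_one, one_mul, one_mul,
    gaussianReal_prod_agreeSet_fract, Real.toNNReal_mul k.cast_nonneg, Real.toNNReal_natCast]
end

section
/- Let F ∈ ℝ and σ > 0. The wrapped Gaussian step density f_s attains its maximum at x = F and its minimum at x = F + 1/2: for every x ∈ ℝ, f_s(F + 1/2) ≤ f_s(x) ≤ f_s(F). -/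
open MeasureTheory Real Set

open HurwitzZeta Filter Topology Asymptotics

lemma hasSum_int_of_even_odd {f : ℤ → ℝ} {a b : ℝ} (ha : HasSum (fun k ↦ f (2 * k)) a)
    (hb : HasSum (fun k ↦ f (2 * k + 1)) b) : HasSum f (a + b) := by
  have h2 := mul_right_injective₀ (two_ne_zero' ℤ)
  have ha' := h2.hasSum_range_iff.2 ha
  have hb' := ((add_left_injective (1 : ℤ)).comp h2).hasSum_range_iff.2 hb
  refine ha'.add_isCompl ?_ hb'
  simpa [Function.comp_def] using Int.isCompl_even_odd

lemma evenKernel_add_int (a t : ℝ) (n : ℤ) :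
    evenKernel ((a + n : ℝ) : UnitAddCircle) t = evenKernel (a : UnitAddCircle) t := by
  have h : ((n : ℝ) : UnitAddCircle) = 0 := (AddCircle.coe_eq_zero_iff 1).2 ⟨n, by simp⟩
  rw [AddCircle.coe_add, h, add_zero]

lemma evenKernel_pos (a : ℝ) {t : ℝ} (ht : 0 < t) : 0 < evenKernel (a : UnitAddCircle) t :=
  (hasSum_int_evenKernel a ht).summable.tsum_pos (fun _ ↦ (Real.exp_pos _).le) 0 (Real.exp_pos _)
    |>.trans_eq (hasSum_int_evenKernel a ht).tsum_eq

/-- Splitting the theta series of `x` at time `t / 2` by the parity of the index. -/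
lemma evenKernel_half_add_evenKernel_half (x : ℝ) {t : ℝ} (ht : 0 < t) :
    evenKernel ((x / 2 : ℝ) : UnitAddCircle) (2 * t) +
      evenKernel (((x + 1) / 2 : ℝ) : UnitAddCircle) (2 * t) =
      evenKernel (x : UnitAddCircle) (t / 2) := by
  refine (hasSum_int_of_even_odd ?_ ?_).unique (hasSum_int_evenKernel x (half_pos ht))
  · convert hasSum_int_evenKernel (x / 2) (t := 2 * t) (by positivity) using 3 with k
    push_cast
    ring
  · convert hasSum_int_evenKernel ((x + 1) / 2) (t := 2 * t) (by positivity) using 3 with k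
    push_cast
    ring

lemma evenKernel_zero_mul (x : ℝ) {t : ℝ} (ht : 0 < t) :
    evenKernel ((0 : ℝ) : UnitAddCircle) t * evenKernel (x : UnitAddCircle) t =
      evenKernel ((x / 2 : ℝ) : UnitAddCircle) (2 * t) ^ 2 +
        evenKernel (((x + 1) / 2 : ℝ) : UnitAddCircle) (2 * t) ^ 2 := by
  have h2t : 0 < 2 * t := by positivity
  have h0 := hasSum_int_evenKernel 0 ht
  have hx := hasSum_int_evenKernel x ht
  have hprod := h0.mul hx <|
    h0.summable.mul_of_nonneg hx.summable (fun _ ↦ (Real.exp_pos _).le) fun _ ↦ (Real.exp_pos _).le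
  obtain ⟨e, he⟩ : ∃ e : ℤ × ℤ ≃ ℤ × ℤ, ∀ p, e p = (p.2, p.1 + p.2) :=
    ⟨{ toFun := fun p ↦ (p.2, p.1 + p.2)
       invFun := fun p ↦ (p.2 - p.1, p.1)
       left_inv := fun p ↦ by simp
       right_inv := fun p ↦ by simp }, fun _ ↦ rfl⟩
  have hterm (p : ℤ × ℤ) : rexp (-π * ((e p).1 + 0) ^ 2 * t) * rexp (-π * ((e p).2 + x) ^ 2 * t) =
      rexp (-π * (p.1 / 2 + x / 2) ^ 2 * (2 * t)) *
        rexp (-π * (p.2 + (x + p.1) / 2) ^ 2 * (2 * t)) := by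
    simp only [he, ← Real.exp_add]
    push_cast
    ring_nf
  have hshear := e.hasSum_iff.2 hprod
  simp only [Function.comp_def, hterm] at hshear
  have hrow (m : ℤ) := (hasSum_int_evenKernel ((x + m) / 2) h2t).mul_left
    (rexp (-π * (m / 2 + x / 2) ^ 2 * (2 * t)))
  have hsum := hshear.prod_fiberwise hrow
  apply hsum.unique
  apply hasSum_int_of_even_odd
  · have heven (k : ℤ) : rexp (-π * ((2 * k : ℤ) / 2 + x / 2) ^ 2 * (2 * t)) *
        evenKernel (((x + (2 * k : ℤ)) / 2 : ℝ) : UnitAddCircle) (2 * t) =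
        rexp (-π * (k + x / 2) ^ 2 * (2 * t)) *
          evenKernel ((x / 2 : ℝ) : UnitAddCircle) (2 * t) := by
      have h : (x + (2 * k : ℤ)) / 2 = x / 2 + k := by push_cast; ring
      rw [h, evenKernel_add_int]
      push_cast
      ring_nf
    simp only [heven, sq (evenKernel _ _)]
    exact (hasSum_int_evenKernel (x / 2) h2t).mul_right _
  · have hodd (k : ℤ) : rexp (-π * ((2 * k + 1 : ℤ) / 2 + x / 2) ^ 2 * (2 * t)) *
        evenKernel (((x + (2 * k + 1 : ℤ)) / 2 : ℝ) : UnitAddCircle) (2 * t) =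
        rexp (-π * (k + (x + 1) / 2) ^ 2 * (2 * t)) *
          evenKernel (((x + 1) / 2 : ℝ) : UnitAddCircle) (2 * t) := by
      have h : (x + (2 * k + 1 : ℤ)) / 2 = (x + 1) / 2 + k := by push_cast; ring
      rw [h, evenKernel_add_int]
      push_cast
      ring_nf
    simp only [hodd, sq (evenKernel _ _)]
    exact (hasSum_int_evenKernel ((x + 1) / 2) h2t).mul_right _

lemma sq_evenKernel_half_le (x : ℝ) {t : ℝ} (ht : 0 < t) :
    evenKernel (x : UnitAddCircle) (t / 2) ^ 2 ≤
      2 * (evenKernel ((0 : ℝ) : UnitAddCircle) t * evenKernel (x : UnitAddCircle) t) := by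
  rw [evenKernel_zero_mul x ht, ← evenKernel_half_add_evenKernel_half x ht]
  exact add_sq_le

lemma sq_evenKernel_half_eq {t : ℝ} (ht : 0 < t) :
    evenKernel ((1 / 2 : ℝ) : UnitAddCircle) (t / 2) ^ 2 =
      2 * (evenKernel ((0 : ℝ) : UnitAddCircle) t *
        evenKernel ((1 / 2 : ℝ) : UnitAddCircle) t) := by
  have h : evenKernel (((1 / 2 + 1) / 2 : ℝ) : UnitAddCircle) (2 * t) =
      evenKernel ((1 / 2 / 2 : ℝ) : UnitAddCircle) (2 * t) := by
    rw [← evenKernel_neg, ← AddCircle.coe_neg, ← evenKernel_add_int _ _ 1]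
    norm_num
  rw [evenKernel_zero_mul _ ht, ← evenKernel_half_add_evenKernel_half _ ht, h]
  ring

lemma evenKernel_div_pow_le (x : ℝ) {t : ℝ} (ht : 0 < t) (n : ℕ) :
    (evenKernel (x : UnitAddCircle) (t / 2 ^ n) /
      evenKernel ((1 / 2 : ℝ) : UnitAddCircle) (t / 2 ^ n)) ^ 2 ^ n ≤
      evenKernel (x : UnitAddCircle) t / evenKernel ((1 / 2 : ℝ) : UnitAddCircle) t := by
  induction n with
  | zero => simp
  | succ n ih =>
    refine le_trans ?_ ih
    have hs : 0 < t / 2 ^ n := by positivity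
    rw [pow_succ' (2 : ℕ) n, pow_mul, pow_succ (2 : ℝ) n, ← div_div]
    refine pow_le_pow_left₀ (sq_nonneg _) ?_ _
    have h0 := evenKernel_pos 0 hs
    have h1 := evenKernel_pos (1 / 2) hs
    rw [div_pow, sq_evenKernel_half_eq hs, div_le_div_iff₀ (by positivity) h1]
    calc _ ≤ _ := mul_le_mul_of_nonneg_right (sq_evenKernel_half_le x hs) h1.le
      _ = _ := by ring

lemma tendsto_cosKernel_atTop (a : UnitAddCircle) : Tendsto (cosKernel a) atTop (𝓝 1) := by
  obtain ⟨p, hp, h⟩ := isBigO_atTop_cosKernel_sub a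
  have h' : Tendsto (fun s : ℝ ↦ rexp (-p * s)) atTop (𝓝 0) :=
    Real.tendsto_exp_atBot.comp (tendsto_id.const_mul_atTop_of_neg (neg_neg_of_pos hp))
  simpa using (h.trans_tendsto h').add_const 1

lemma tendsto_mul_cosKernel_sub_one_atTop (a : UnitAddCircle) :
    Tendsto (fun s ↦ s * (cosKernel a s - 1)) atTop (𝓝 0) := by
  obtain ⟨p, hp, h⟩ := isBigO_atTop_cosKernel_sub a
  have h' : Tendsto (fun s : ℝ ↦ s * rexp (-p * s)) atTop (𝓝 0) := by
    simpa using tendsto_rpow_mul_exp_neg_mul_atTop_nhds_zero 1 p hp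
  exact ((isBigO_refl (fun s : ℝ ↦ s) atTop).mul h).trans_tendsto h'

/-- The theta function `evenKernel · t` is minimal at `1 / 2`. -/
lemma evenKernel_half_le (x : ℝ) {t : ℝ} (ht : 0 < t) :
    evenKernel ((1 / 2 : ℝ) : UnitAddCircle) t ≤ evenKernel (x : UnitAddCircle) t := by
  rw [← one_le_div (evenKernel_pos _ ht)]
  set y : UnitAddCircle := ((1 / 2 : ℝ) : UnitAddCircle)
  have hs : Tendsto (fun n : ℕ ↦ (2 : ℝ) ^ n / t) atTop atTop :=
    (tendsto_pow_atTop_atTop_of_one_lt one_lt_two).atTop_div_const ht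
  have hlim : Tendsto (fun s ↦ 1 + t * ((s * (cosKernel x s - 1) - s * (cosKernel y s - 1)) /
      cosKernel y s)) atTop (𝓝 1) := by
    simpa using ((((tendsto_mul_cosKernel_sub_one_atTop x).sub
      (tendsto_mul_cosKernel_sub_one_atTop y)).div (tendsto_cosKernel_atTop y)
        one_ne_zero).const_mul t).const_add 1
  refine le_of_tendsto (hlim.comp hs) (Eventually.of_forall fun n ↦ ?_)
  refine le_trans ?_ (evenKernel_div_pow_le x ht n)
  have hn : 0 < t / 2 ^ n := by positivity
  have hx := evenKernel_pos x hn
  have hy : 0 < evenKernel y (t / 2 ^ n) := evenKernel_pos (1 / 2) hn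
  have hr : evenKernel (x : UnitAddCircle) (t / 2 ^ n) / evenKernel y (t / 2 ^ n) =
      cosKernel x (2 ^ n / t) / cosKernel y (2 ^ n / t) := by
    rw [evenKernel_functional_equation, evenKernel_functional_equation, one_div_div,
      mul_div_mul_left _ _ (by positivity)]
  have hc : cosKernel y (2 ^ n / t) ≠ 0 := by
    rw [evenKernel_functional_equation, one_div_div] at hy
    exact (right_ne_zero_of_mul hy.ne')
  have hb := one_add_mul_sub_le_pow (a := evenKernel (x : UnitAddCircle) (t / 2 ^ n) /
    evenKernel y (t / 2 ^ n)) (by have := div_pos hx hy; linarith) (2 ^ n)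
  refine le_trans (le_of_eq ?_) hb
  rw [hr]
  simp only [Function.comp_apply]
  push_cast
  field_simp
  ring

lemma cosKernel_le_cosKernel_zero (x : ℝ) {t : ℝ} (ht : 0 < t) :
    cosKernel (x : UnitAddCircle) t ≤ cosKernel ((0 : ℝ) : UnitAddCircle) t := by
  rw [← sub_le_sub_iff_right 1]
  refine hasSum_le (fun n ↦ ?_) (hasSum_nat_cosKernel₀ x ht) (hasSum_nat_cosKernel₀ 0 ht)
  gcongr
  simpa using Real.cos_le_one _

/-- The theta function `evenKernel · t` is maximal at `0`. -/
lemma evenKernel_le_evenKernel_zero (x : ℝ) {t : ℝ} (ht : 0 < t) :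
    evenKernel (x : UnitAddCircle) t ≤ evenKernel ((0 : ℝ) : UnitAddCircle) t := by
  rw [evenKernel_functional_equation, evenKernel_functional_equation]
  gcongr
  exact cosKernel_le_cosKernel_zero x (by positivity)

lemma stepDensity_eq_evenKernel (F x : ℝ) {v : ℝ} (hv : 0 < v) :
    stepDensity F v x =
      1 / √(2 * π * v) * evenKernel ((x - F : ℝ) : UnitAddCircle) (1 / (2 * π * v)) := by
  rw [stepDensity, ← (hasSum_int_evenKernel (x - F) (by positivity)).tsum_eq]
  congr 2 with i
  congr 1
  field_simp
  ring

/-- The wrapped Gaussian step density with parameters `(F, σ²)`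
attains its maximum at `x = F` and its minimum at `x = F + 1/2`: for every `x`,
`f_s(F + 1/2) ≤ f_s(x) ≤ f_s(F)`. -/
theorem stepDensity_extrema (F σ : ℝ) (hσ : 0 < σ) (x : ℝ) :
    stepDensity F (σ^2) (F + 1/2) ≤ stepDensity F (σ^2) x ∧
      stepDensity F (σ^2) x ≤ stepDensity F (σ^2) F := by
  have hv : 0 < σ ^ 2 := by positivity
  have ht : 0 < 1 / (2 * π * σ ^ 2) := by positivity
  simp only [stepDensity_eq_evenKernel _ _ hv, add_sub_cancel_left, sub_self]
  constructor
  · gcongr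
    exact evenKernel_half_le _ ht
  · gcongr
    exact evenKernel_le_evenKernel_zero _ ht
end

section
/- Let F ∈ ℝ and σ > 0. The total variation distance between the distribution on [0,1) with density f_s and the uniform distribution on [0,1) is bounded by the density maximum: (1/2) ∫_0^1 |f_s(x) − 1| dx ≤ f_s(F) − 1. -/
open MeasureTheory Real Set

open HurwitzZeta in
/-- Poisson summation: the step density is a Jacobi theta function of the phase `x - F`. -/
theorem stepDensity_eq_cosKernel (F x : ℝ) {v : ℝ} (hv : 0 < v) :
    stepDensity F v x = cosKernel ((x - F : ℝ) : UnitAddCircle) (2 * π * v) := by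
  have hs : 0 < 2 * π * v := by positivity
  have hsum : ∑' i : ℤ, rexp (-(x - F + (i : ℝ)) ^ 2 / (2 * v)) =
      evenKernel ((x - F : ℝ) : UnitAddCircle) (1 / (2 * π * v)) := by
    rw [← (hasSum_int_evenKernel (x - F) (one_div_pos.mpr hs)).tsum_eq]
    congr 1 with i
    congr 1
    field_simp
    ring
  rw [stepDensity, hsum, evenKernel_functional_equation, one_div_one_div,
    one_div (2 * π * v), Real.inv_rpow hs.le, ← Real.sqrt_eq_rpow]
  have : √(2 * π * v) ≠ 0 := (Real.sqrt_pos.mpr hs).ne'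
  field_simp

open HurwitzZeta in
/-- The deviation of the cosine kernel from its constant Fourier mode is largest at `0`. -/
theorem abs_cosKernel_sub_one_le (a : ℝ) {t : ℝ} (ht : 0 < t) :
    |cosKernel (a : UnitAddCircle) t - 1| ≤ cosKernel ((0 : ℝ) : UnitAddCircle) t - 1 := by
  have ha := hasSum_int_cosKernel₀ a ht
  have h0 : HasSum (fun n : ℤ ↦ if n = 0 then 0 else rexp (-π * n ^ 2 * t))
      (cosKernel ((0 : ℝ) : UnitAddCircle) t - 1) := by
    rw [← Complex.hasSum_ofReal]
    convert hasSum_int_cosKernel₀ 0 ht using 1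
    · ext n
      split_ifs <;> simp
    · push_cast
      rfl
  have hle := tsum_of_norm_bounded h0 (f := fun n : ℤ ↦ if n = 0 then (0 : ℂ) else
    Complex.exp (2 * π * Complex.I * a * n) * rexp (-π * n ^ 2 * t)) fun n ↦ by
      split_ifs
      · simp
      · rw [norm_mul, Complex.norm_real, Real.norm_of_nonneg (Real.exp_nonneg _),
          Complex.norm_exp]
        simp
  rwa [ha.tsum_eq, ← Complex.ofReal_one, ← Complex.ofReal_sub, Complex.norm_real,
    Real.norm_eq_abs] at hle

/-- The total variation distance of the distribution with density
`f_s` (parameters `(F, σ²)`) on `[0,1)` from the uniform distribution on `[0,1)` is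
bounded by the density maximum: `(1/2)·∫_0^1 |f_s(x) − 1| dx ≤ f_s(F) − 1`. -/
theorem stepDensity_tv_le (F σ : ℝ) (hσ : 0 < σ) :
    (1/2) * ∫ x in (0:ℝ)..1, |stepDensity F (σ^2) x - 1|
      ≤ stepDensity F (σ^2) F - 1 := by
  have hv : 0 < σ ^ 2 := by positivity
  have hbound : ∀ x, |stepDensity F (σ ^ 2) x - 1| ≤ stepDensity F (σ ^ 2) F - 1 := fun x ↦ by
    rw [stepDensity_eq_cosKernel F x hv, stepDensity_eq_cosKernel F F hv, sub_self]
    exact abs_cosKernel_sub_one_le _ (by positivity)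
  have hint := intervalIntegral.norm_integral_le_of_norm_le_const (a := 0) (b := 1)
    (f := fun x ↦ |stepDensity F (σ ^ 2) x - 1|) fun x _ ↦ by simpa using hbound x
  have hnonneg := (abs_nonneg _).trans (hbound F)
  rw [sub_zero, abs_one, mul_one] at hint
  linarith [le_of_abs_le hint]
end

section
/- Let F ∈ ℝ, D ∈ (0,1), σ > 0, and n ≥ 1. For every bit pattern z ∈ {0,1}^n, the probability Pr(Z_n = z) under the sampling process with parameters (F, D, σ²) equals the probability Pr(Z_n = z) under the sampling process with parameters ((1 − F) mod 1, D, σ²); i.e. bit pattern probabilities are invariant under the frequency sign change F ↦ −F mod 1. -/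
open MeasureTheory ProbabilityTheory Real Set

/-- Reflecting a uniform phase in `[0,1)` at an arbitrary point preserves its law. -/
lemma measurePreserving_fract_sub (D : ℝ) :
    MeasurePreserving (fun x : ℝ => Int.fract (D - x))
      (volume.restrict (Set.Ico (0:ℝ) 1)) (volume.restrict (Set.Ico (0:ℝ) 1)) := by
  have hm : Measurable fun x : ℝ => Int.fract (D - x) := by fun_prop
  refine ⟨hm, ?_⟩
  ext A hA
  rw [Measure.map_apply hm hA, Measure.restrict_apply (hm hA), Measure.restrict_apply hA]
  have hB : MeasurableSet (Int.fract ⁻¹' A : Set ℝ) := measurable_fract hA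
  have h1 : (fun x : ℝ => Int.fract (D - x)) ⁻¹' A ∩ Ico 0 1
      = (fun x : ℝ => D - x) ⁻¹' (Int.fract ⁻¹' A ∩ Ioc (D - 1) (D - 1 + 1)) := by
    ext x
    simp only [mem_inter_iff, mem_preimage, mem_Ico, mem_Ioc]
    refine and_congr_right fun _ => ⟨fun h => ?_, fun h => ?_⟩ <;> constructor <;> linarith [h.1, h.2]
  have h2 : A ∩ Ico 0 1 = Int.fract ⁻¹' A ∩ Ico 0 1 := by
    ext x
    simp only [mem_inter_iff, mem_preimage]
    refine and_congr_left fun h => ?_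
    rw [Int.fract_eq_self.2 h]
  have h3 : volume (Int.fract ⁻¹' A ∩ Ico (0:ℝ) 1)
      = volume (Int.fract ⁻¹' A ∩ Ioc (0:ℝ) (0 + 1)) := by
    rw [zero_add]
    exact measure_congr ((ae_eq_refl _).inter Ico_ae_eq_Ioc)
  rw [h1, h2, h3, (Measure.measurePreserving_sub_left (volume : Measure ℝ) D).measure_preimage
    (hB.inter measurableSet_Ioc).nullMeasurableSet]
  refine (isAddFundamentalDomain_Ioc one_pos (D - 1)).measure_set_eq
    (isAddFundamentalDomain_Ioc one_pos 0) hB fun g => ?_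
  obtain ⟨m, hm⟩ := AddSubgroup.mem_zmultiples_iff.1 g.2
  ext x
  have : g +ᵥ x = x + (m : ℝ) := by
    change (g : ℝ) + x = _
    rw [← hm]
    simp [add_comm]
  simp [this]

lemma measurePreserving_intCast_sub_stepGauss (F v : ℝ) (k : ℤ) :
    MeasurePreserving (fun y : ℝ => (k : ℝ) - y) (stepGauss F v) (stepGauss (k - F) v) :=
  ⟨by fun_prop, gaussianReal_map_const_sub _⟩

instance (F v : ℝ) : IsProbabilityMeasure (stepGauss F v) := by
  unfold stepGauss; infer_instance

/-- The reflection of the sampling process at phase `D`, with integer shifts of the increments. -/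
noncomputable def reflectPath (D : ℝ) (k : ℤ) {n : ℕ} (ω : ℝ × (Fin n → ℝ)) :
    ℝ × (Fin n → ℝ) :=
  (Int.fract (D - ω.1), fun i => (k : ℝ) - ω.2 i)

lemma measurePreserving_reflectPath (F D v : ℝ) (k : ℤ) (n : ℕ) :
    MeasurePreserving (reflectPath D k) (procMeasure F v n) (procMeasure (k - F) v n) :=
  (measurePreserving_fract_sub D).prod
    (measurePreserving_pi _ _ fun _ => measurePreserving_intCast_sub_stepGauss F v k)

lemma phase_reflectPath (D : ℝ) (k : ℤ) {n : ℕ} (ω : ℝ × (Fin n → ℝ)) (j : ℕ) :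
    phase (reflectPath D k ω) j = Int.fract (D - phase ω j) := by
  unfold phase reflectPath
  rw [Int.fract_eq_fract]
  have h : (∑ i : Fin n, if (i : ℕ) < j then (k : ℝ) - ω.2 i else 0)
      = ((∑ i : Fin n, if (i : ℕ) < j then k else 0 : ℤ) : ℝ)
        - ∑ i : Fin n, if (i : ℕ) < j then ω.2 i else 0 := by
    push_cast
    rw [← Finset.sum_sub_distrib]
    refine Finset.sum_congr rfl fun i _ => ?_
    split_ifs <;> simp
  refine ⟨(∑ i : Fin n, if (i : ℕ) < j then k else 0) - ⌊D - ω.1⌋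
    - ⌊ω.1 + ∑ i : Fin n, if (i : ℕ) < j then ω.2 i else 0⌋, ?_⟩
  simp only [h, Int.fract]
  push_cast
  ring

lemma measurable_phase {n : ℕ} (j : ℕ) : Measurable fun ω : ℝ × (Fin n → ℝ) => phase ω j := by
  unfold phase
  refine measurable_fract.comp (measurable_fst.add (Finset.measurable_sum _ fun i _ => ?_))
  split_ifs <;> fun_prop

lemma ae_phase_ne (F v a : ℝ) {n : ℕ} (j : ℕ) :
    ∀ᵐ ω ∂procMeasure F v n, phase ω j ≠ a := by
  have hs : MeasurableSet {ω : ℝ × (Fin n → ℝ) | phase ω j = a} :=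
    measurable_phase j (measurableSet_singleton a)
  rw [ae_iff]
  simp only [ne_eq, not_not]
  rw [procMeasure, Measure.prod_apply_symm hs,
    lintegral_eq_zero_iff (measurable_measure_prodMk_right hs)]
  refine Filter.Eventually.of_forall fun y => Set.Countable.measure_zero ?_ _
  refine (countable_range fun m : ℤ =>
    a + m - ∑ i : Fin n, if (i : ℕ) < j then y i else 0).mono fun x hx => ?_
  have hx : Int.fract (x + ∑ i : Fin n, if (i : ℕ) < j then y i else 0) = a := hx
  refine ⟨⌊x + ∑ i : Fin n, if (i : ℕ) < j then y i else 0⌋, ?_⟩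
  simp only
  rw [← hx, Int.fract]
  ring

lemma bit_fract_sub {D x : ℝ} (hD : D ∈ Ioo (0:ℝ) 1) (hx : x ∈ Ioo (0:ℝ) 1) (hxD : x ≠ D) :
    bit D (Int.fract (D - x)) = bit D x := by
  unfold bit
  rw [decide_eq_decide]
  rcases lt_or_gt_of_ne hxD with h | h
  · rw [Int.fract_eq_self.2 ⟨by linarith, by linarith [hx.1, hD.2]⟩]
    exact iff_of_true (by linarith [hx.1]) h
  · rw [← Int.fract_add_one, Int.fract_eq_self.2 ⟨by linarith [hx.2, hD.1], by linarith⟩]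
    exact iff_of_false (by linarith [hx.2]) (by linarith)

lemma measurableSet_pattern (D : ℝ) {n : ℕ} (z : Fin n → Bool) :
    MeasurableSet {ω : ℝ × (Fin n → ℝ) | ∀ j : Fin n, bit D (phase ω ((j : ℕ) + 1)) = z j} := by
  rw [Set.ofPred_forall]
  refine MeasurableSet.iInter fun j => ?_
  have h : MeasurableSet {ω : ℝ × (Fin n → ℝ) | phase ω ((j : ℕ) + 1) < D} :=
    measurable_phase _ measurableSet_Iio
  cases hz : z j
  · simp only [bit, decide_eq_false_iff_not]
    exact h.compl
  · simpa only [bit, decide_eq_true_eq] using h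

/-- For every `n ≥ 1` and every bit pattern `z ∈ {0,1}ⁿ`, the
probability `Pr(Z_n = z)` under the sampling process with parameters `(F, D, σ²)`
equals `Pr(Z_n = z)` under parameters `((1 − F) mod 1, D, σ²)`: bit pattern
probabilities are invariant under the frequency sign change `F ↦ −F mod 1`. -/
theorem patternProb_neg_freq (F D σ : ℝ) (hD : D ∈ Set.Ioo (0:ℝ) 1) (hσ : 0 < σ)
    (n : ℕ) (hn : 1 ≤ n) (z : Fin n → Bool) :
    patternProb F D (σ^2) n z = patternProb (Int.fract (1 - F)) D (σ^2) n z := by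
  obtain ⟨k, hk⟩ : ∃ k : ℤ, Int.fract (1 - F) = k - F :=
    ⟨1 - ⌊1 - F⌋, by rw [Int.fract]; push_cast; ring⟩
  unfold patternProb
  rw [hk, ← (measurePreserving_reflectPath F D (σ ^ 2) k n).measure_preimage
    (measurableSet_pattern D z).nullMeasurableSet]
  congr 1
  refine measure_congr (Filter.eventuallyEq_set.2 ?_)
  have h0 := ae_all_iff.2 fun j : Fin n => ae_phase_ne F (σ ^ 2) 0 (n := n) ((j : ℕ) + 1)
  have h1 := ae_all_iff.2 fun j : Fin n => ae_phase_ne F (σ ^ 2) D (n := n) ((j : ℕ) + 1)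
  filter_upwards [h0, h1] with ω hω0 hωD
  refine forall_congr' fun j => ?_
  have hmem : phase ω ((j : ℕ) + 1) ∈ Ioo (0:ℝ) 1 :=
    ⟨lt_of_le_of_ne (Int.fract_nonneg _) (hω0 j).symm, Int.fract_lt_one _⟩
  rw [phase_reflectPath, bit_fract_sub hD hmem (hωD j)]
end

section
/- Fix F ∈ ℝ, D ∈ (0,1) and an integer n ≥ 1. For x₀ ∈ [0,1) and 1 ≤ i ≤ n define z_i(x₀) = 1 if (x₀ + iF) mod 1 < D and z_i(x₀) = 0 otherwise. Then the set of words { (z_1(x₀), …, z_n(x₀)) : x₀ ∈ [0,1) } ⊆ {0,1}^n has cardinality at most 2n. -/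
open Set

/-- Rotating `y` back by `t` keeps its side of the threshold `D`, as long as it crosses neither
`0` nor `D` modulo one. -/
theorem fract_sub_lt_iff_fract_lt {y t D : ℝ} (hD : D ∈ Set.Ioo (0 : ℝ) 1) (ht : 0 ≤ t)
    (hy : t ≤ Int.fract y) (hyD : t ≤ Int.fract (y - D)) :
    Int.fract (y - t) < D ↔ Int.fract y < D := by
  obtain ⟨hD0, hD1⟩ := hD
  have hf := Int.fract_lt_one y
  have hyt : Int.fract (y - t) = Int.fract y - t :=
    Int.fract_eq_iff.2 ⟨by linarith, by linarith, ⌊y⌋, by linarith [Int.self_sub_floor y]⟩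
  rw [hyt]
  refine ⟨fun h => ?_, fun h => by linarith⟩
  by_contra! hDy
  have hfD : Int.fract (y - D) = Int.fract y - D :=
    Int.fract_eq_iff.2 ⟨by linarith, by linarith, ⌊y⌋, by linarith [Int.self_sub_floor y]⟩
  linarith

/-- Fix `F ∈ ℝ`, `D ∈ (0,1)` and `n ≥ 1`. For `x₀ ∈ [0,1)` and
`1 ≤ i ≤ n` let `z_i(x₀) = 1` iff `(x₀ + iF) mod 1 < D` (the noiseless sampling
process). Then the set of words `{(z_1(x₀), …, z_n(x₀)) : x₀ ∈ [0,1)} ⊆ {0,1}ⁿ`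
has cardinality at most `2n`. -/
theorem noiseless_word_count (F D : ℝ) (hD : D ∈ Set.Ioo (0:ℝ) 1) (n : ℕ) (hn : 1 ≤ n) :
    Set.ncard {w : Fin n → Bool | ∃ x₀ ∈ Set.Ico (0:ℝ) 1,
        w = fun i : Fin n => decide (Int.fract (x₀ + ((i : ℕ) + 1) * F) < D)}
      ≤ 2 * n := by
  let word : ℝ → Fin n → Bool :=
    fun x i => decide (Int.fract (x + ((i : ℕ) + 1) * F) < D)
  let c : Fin n × Bool → ℝ := fun p => (if p.2 then D else 0) - ((p.1 : ℕ) + 1) * F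
  have : Nonempty (Fin n × Bool) := ⟨(⟨0, hn⟩, true)⟩
  have hsub : {w : Fin n → Bool | ∃ x₀ ∈ Set.Ico (0:ℝ) 1, w = word x₀} ⊆
      Set.range fun p => word (c p) := by
    rintro _ ⟨x, -, rfl⟩
    obtain ⟨p, hp⟩ := Finite.exists_min fun p => Int.fract (x - c p)
    refine ⟨p, funext fun i => decide_eq_decide.2 ?_⟩
    have h0 := hp (i, false)
    have h1 := hp (i, true)
    have e0 : x - c (i, false) = x + ((i : ℕ) + 1) * F := by simp [c]
    have e1 : x - c (i, true) = x + ((i : ℕ) + 1) * F - D := by simp [c]; ring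
    rw [e0] at h0
    rw [e1] at h1
    rw [← fract_sub_lt_iff_fract_lt hD (Int.fract_nonneg _) h0 h1]
    have e : x + ((i : ℕ) + 1) * F - Int.fract (x - c p) =
        c p + ((i : ℕ) + 1) * F + (⌊x - c p⌋ : ℤ) := by
      linarith [Int.self_sub_floor (x - c p)]
    rw [e, Int.fract_add_intCast]
  calc _ ≤ (Set.range fun p => word (c p)).ncard :=
        Set.ncard_le_ncard hsub (Set.finite_range _)
    _ ≤ Nat.card (Fin n × Bool) := by
        rw [← Set.image_univ, ← Set.ncard_univ]
        exact Set.ncard_image_le Set.finite_univ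
    _ = 2 * n := by simp [mul_comm]
end

section
/- Fix F ∈ ℝ and D ∈ (0,1), let x₀ be uniformly distributed on [0,1), and for 1 ≤ i ≤ n let z_i = 1 if (x₀ + iF) mod 1 < D and z_i = 0 otherwise (the noiseless sampling process, σ² = 0). Then the Shannon entropy of Z_n = (z_1, …, z_n) satisfies H_1(Z_n) ≤ log₂(2n) for all n ≥ 1, and consequently the entropy rate is zero: (1/n)·H_1(Z_n) → 0 as n → ∞. -/
open MeasureTheory Real Set Filter

/-- Probability of the bit pattern `z` for the noiseless (`σ² = 0`) sampling
process with frequency `F` and duty cycle `D`: `x₀` is uniform on `[0,1)` and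
`z_i = 1` iff `(x₀ + iF) mod 1 < D` for `1 ≤ i ≤ n`. -/
noncomputable def noiselessProb (F D : ℝ) (n : ℕ) (z : Fin n → Bool) : ℝ :=
  ((volume.restrict (Set.Ico (0:ℝ) 1))
      {x₀ | ∀ i : Fin n, decide (Int.fract (x₀ + ((i : ℕ) + 1) * F) < D) = z i}).toReal

/-- Shannon entropy `H_1(Z_n) = −Σ_z p_z·log₂ p_z` of the noiseless process.
(Note `Real.logb 2 0 = 0`, so the convention `0·log₂ 0 = 0` holds automatically.) -/
noncomputable def noiselessH (F D : ℝ) (n : ℕ) : ℝ :=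
  -∑ z : Fin n → Bool, noiselessProb F D n z * Real.logb 2 (noiselessProb F D n z)

/-- The bit pattern produced by the noiseless sampling process started at `x`. -/
noncomputable def noiselessPattern (F D : ℝ) (n : ℕ) (x : ℝ) : Fin n → Bool :=
  fun i => decide (Int.fract (x + ((i : ℕ) + 1) * F) < D)

lemma measurable_noiselessPattern (F D : ℝ) (n : ℕ) : Measurable (noiselessPattern F D n) := by
  refine measurable_pi_lambda _ fun i => measurable_to_bool ?_
  have h : Measurable fun x : ℝ => Int.fract (x + ((i : ℕ) + 1) * F) :=
    measurable_fract.comp (measurable_id.add_const _)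
  convert measurableSet_lt h (measurable_const (a := D)) using 1
  ext x
  simp [noiselessPattern]

lemma noiselessProb_eq (F D : ℝ) (n : ℕ) (z : Fin n → Bool) :
    noiselessProb F D n z =
      (volume.restrict (Set.Ico (0 : ℝ) 1)).real (noiselessPattern F D n ⁻¹' {z}) := by
  unfold noiselessProb Measure.real
  congr 2
  ext x
  simp [noiselessPattern, funext_iff]

lemma noiselessProb_nonneg (F D : ℝ) (n : ℕ) (z : Fin n → Bool) : 0 ≤ noiselessProb F D n z :=
  ENNReal.toReal_nonneg

lemma sum_noiselessProb (F D : ℝ) (n : ℕ) : ∑ z, noiselessProb F D n z = 1 := by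
  simp_rw [noiselessProb_eq]
  rw [sum_measureReal_preimage_singleton _
    fun z _ => measurable_noiselessPattern F D n (measurableSet_singleton z)]
  simp [Measure.real]

/-- If translating `u` by `t` on the circle meets neither `0` nor `D`, then it preserves membership
in the arc `[0, D)`. -/
lemma fract_add_lt_iff {D u t : ℝ} (hD : 0 < D) (ht : t ∈ Set.Ico (0 : ℝ) 1)
    (h0 : t ≤ Int.fract (u + t)) (h1 : t ≤ Int.fract (u + t - D)) :
    Int.fract (u + t) < D ↔ Int.fract u < D := by
  have hu0 := Int.fract_nonneg u
  have hu1 := Int.fract_lt_one u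
  have hv : Int.fract (u + t) = Int.fract u + t := by
    by_cases hlt : Int.fract u + t < 1
    · rw [Int.fract_eq_iff]
      exact ⟨by linarith [ht.1], hlt, ⌊u⌋, by linarith [Int.self_sub_floor u]⟩
    · have : Int.fract (u + t) = Int.fract u + t - 1 := by
        rw [Int.fract_eq_iff]
        exact ⟨by linarith, by linarith [ht.2], ⌊u⌋ + 1, by
          push_cast; linarith [Int.self_sub_floor u]⟩
      linarith
  refine ⟨fun h => by linarith [ht.1], fun h => ?_⟩
  by_contra! hge
  have : Int.fract (u + t - D) = Int.fract (u + t) - D := by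
    rw [Int.fract_eq_iff]
    exact ⟨by linarith, by linarith [Int.fract_lt_one (u + t)], ⌊u + t⌋, by
      linarith [Int.self_sub_floor (u + t)]⟩
  linarith

/-- Every pattern is produced by one of the `2n` breakpoints `-iF`, `D - iF`. -/
lemma exists_noiselessPattern_eq {F D : ℝ} (hD : D ∈ Set.Ioo (0 : ℝ) 1) {n : ℕ} (hn : 1 ≤ n)
    (x : ℝ) : ∃ j : Fin n × Bool,
      noiselessPattern F D n ((if j.2 then D else 0) - ((j.1 : ℕ) + 1) * F) =
        noiselessPattern F D n x := by
  have : Nonempty (Fin n) := ⟨⟨0, hn⟩⟩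
  obtain ⟨j, hj⟩ := Finite.exists_min fun j : Fin n × Bool =>
    Int.fract (x - ((if j.2 then D else 0) - ((j.1 : ℕ) + 1) * F))
  refine ⟨j, ?_⟩
  set c : ℝ := (if j.2 then D else 0) - ((j.1 : ℕ) + 1) * F
  funext i
  have hshift (y : ℝ) : Int.fract (c + y + Int.fract (x - c)) = Int.fract (x + y) := by
    rw [Int.fract_eq_fract]
    exact ⟨-⌊x - c⌋, by push_cast; linarith [Int.self_sub_floor (x - c)]⟩
  have key := fract_add_lt_iff (u := c + ((i : ℕ) + 1) * F) (t := Int.fract (x - c)) hD.1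
    ⟨Int.fract_nonneg _, Int.fract_lt_one _⟩ ?_ ?_
  · rw [hshift] at key
    simp only [noiselessPattern, key]
  · rw [hshift]
    simpa using hj (i, false)
  · have h := hj (i, true)
    simp only [if_true] at h
    rw [show c + ((i : ℕ) + 1) * F + Int.fract (x - c) - D =
      c + (((i : ℕ) + 1) * F - D) + Int.fract (x - c) by ring, hshift]
    rwa [show x + (((i : ℕ) + 1) * F - D) = x - (D - ((i : ℕ) + 1) * F) by ring]

lemma exists_finset_noiselessProb_eq_zero (F : ℝ) {D : ℝ} (hD : D ∈ Set.Ioo (0 : ℝ) 1) {n : ℕ}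
    (hn : 1 ≤ n) : ∃ T : Finset (Fin n → Bool), T.card ≤ 2 * n ∧
      ∀ z ∉ T, noiselessProb F D n z = 0 := by
  refine ⟨Finset.univ.image fun j : Fin n × Bool =>
    noiselessPattern F D n ((if j.2 then D else 0) - ((j.1 : ℕ) + 1) * F),
    Finset.card_image_le.trans (by simp [mul_comm]), fun z hz => ?_⟩
  have hempty : noiselessPattern F D n ⁻¹' {z} = ∅ := by
    refine Set.eq_empty_of_forall_notMem fun x hx => hz ?_
    obtain ⟨j, hj⟩ := exists_noiselessPattern_eq (F := F) hD hn x
    exact Finset.mem_image.2 ⟨j, Finset.mem_univ _, hj.trans hx⟩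
  rw [noiselessProb_eq, hempty, measureReal_empty]

/-- A probability vector supported on at most `N` points has entropy at most `log₂ N`. -/
lemma entropy_le_logb_of_card_le {ι : Type*} [Fintype ι] {p : ι → ℝ} (hp : ∀ z, 0 ≤ p z)
    (hsum : ∑ z, p z = 1) {T : Finset ι} (hT : ∀ z ∉ T, p z = 0) {N : ℝ} (hN : 0 < N)
    (hcard : (T.card : ℝ) ≤ N) : -∑ z, p z * Real.logb 2 (p z) ≤ Real.logb 2 N := by
  have hsub (f : ι → ℝ) (hf : ∀ z, p z = 0 → f z = 0) : ∑ z, f z = ∑ z ∈ T, f z :=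
    (Finset.sum_subset (Finset.subset_univ T) fun z _ hz => hf z (hT z hz)).symm
  have hterm (z : ι) : -(p z * Real.log (p z)) ≤ p z * Real.log N + (1 / N - p z) := by
    rcases (hp z).eq_or_lt with h | h
    · rw [← h]
      simpa using hN.le
    · have hlog := Real.log_le_sub_one_of_pos (x := 1 / (p z * N)) (by positivity)
      rw [one_div, Real.log_inv, Real.log_mul h.ne' hN.ne'] at hlog
      have hmul := mul_le_mul_of_nonneg_left hlog h.le
      have hcancel : p z * ((p z * N)⁻¹ - 1) = 1 / N - p z := by field_simp
      rw [hcancel] at hmul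
      linarith
  have hnat : -∑ z, p z * Real.log (p z) ≤ Real.log N := by
    rw [hsub _ fun z hz => by simp [hz], ← Finset.sum_neg_distrib]
    refine (Finset.sum_le_sum fun z _ => hterm z).trans ?_
    rw [Finset.sum_add_distrib, Finset.sum_sub_distrib, ← Finset.sum_mul,
      ← hsub p fun z hz => hz, hsum, Finset.sum_const, nsmul_eq_mul, mul_one_div]
    have := (div_le_one hN).2 hcard
    linarith
  simp only [Real.logb, ← mul_div_assoc]
  rw [← Finset.sum_div, ← neg_div]
  exact div_le_div_of_nonneg_right hnat (Real.log_nonneg one_le_two)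

lemma noiselessH_le (F : ℝ) {D : ℝ} (hD : D ∈ Set.Ioo (0 : ℝ) 1) {n : ℕ} (hn : 1 ≤ n) :
    noiselessH F D n ≤ Real.logb 2 (2 * (n : ℝ)) := by
  obtain ⟨T, hcard, hT⟩ := exists_finset_noiselessProb_eq_zero F hD hn
  exact entropy_le_logb_of_card_le (noiselessProb_nonneg F D n) (sum_noiselessProb F D n) hT
    (by positivity) (by exact_mod_cast hcard)

lemma noiselessH_nonneg (F D : ℝ) (n : ℕ) : 0 ≤ noiselessH F D n := by
  refine neg_nonneg.2 (Finset.sum_nonpos fun z _ => ?_)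
  have hle : noiselessProb F D n z ≤ 1 := by
    rw [← sum_noiselessProb F D n]
    exact Finset.single_le_sum (fun z _ => noiselessProb_nonneg F D n z) (Finset.mem_univ z)
  exact mul_nonpos_of_nonneg_of_nonpos (noiselessProb_nonneg F D n z)
    (Real.logb_nonpos one_lt_two (noiselessProb_nonneg F D n z) hle)

lemma tendsto_logb_two_mul_div :
    Tendsto (fun n : ℕ => (1 / (n : ℝ)) * Real.logb 2 (2 * (n : ℝ))) atTop (nhds 0) := by
  have h := (Real.tendsto_pow_log_div_mul_add_atTop (1 / 2) 0 1 (by norm_num)).comp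
    (tendsto_natCast_atTop_atTop.const_mul_atTop (two_pos (α := ℝ)))
  have h' := h.div_const (Real.log 2)
  rw [zero_div] at h'
  refine h'.congr fun n => ?_
  simp only [Function.comp_apply, Real.logb, pow_one, add_zero]
  ring

/-- For the noiseless (`σ² = 0`) sampling process, the Shannon
entropy satisfies `H_1(Z_n) ≤ log₂(2n)` for all `n ≥ 1`, and consequently the
entropy rate is zero: `(1/n)·H_1(Z_n) → 0` as `n → ∞`. -/
theorem noiseless_entropy_rate_zero (F D : ℝ) (hD : D ∈ Set.Ioo (0:ℝ) 1) :
    (∀ n : ℕ, 1 ≤ n → noiselessH F D n ≤ Real.logb 2 (2 * (n : ℝ))) ∧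
    Tendsto (fun n : ℕ => (1 / (n : ℝ)) * noiselessH F D n) atTop (nhds 0) := by
  refine ⟨fun n hn => noiselessH_le F hD hn, ?_⟩
  refine tendsto_of_tendsto_of_tendsto_of_le_of_le' tendsto_const_nhds tendsto_logb_two_mul_div
    (Eventually.of_forall fun n => mul_nonneg (by positivity) (noiselessH_nonneg F D n)) ?_
  filter_upwards [eventually_ge_atTop 1] with n hn
  exact mul_le_mul_of_nonneg_left (noiselessH_le F hD hn) (by positivity)
end
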